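/- Let n ≥ 1 and 1 ≤ q < p < ∞, and let A and B be n×n positive definite Hermitian matrices. Then ‖A^{1/p} B^{−1/p}‖ ≤ c_n · ‖A^{1/q} B^{−1/q}‖^{q/p}, where ‖·‖ is the operator norm, fractional powers are defined by the spectral calculus of positive definite matrices, and c_n is a constant depending only on n (one may take c_n = n). -/

import Mathlib

open MeasureTheory ENNReal
open scoped ComplexOrder

noncomputable section

abbrev Rd (d : ℕ) := EuclideanSpace ℝ (Fin d)
abbrev Mat (n : ℕ) := Matrix (Fin n) (Fin n) ℂ
abbrev Vec (n : ℕ) := EuclideanSpace ℂ (Fin n)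

/-- A cube in `ℝ^d` with sides parallel to the coordinate axes, given by its
lower-left corner and (positive) side length. -/
structure Cube (d : ℕ) where
  corner : Rd d
  side : ℝ
  side_pos : 0 < side

namespace Cube

/-- The underlying set of the cube. -/
def set {d : ℕ} (Q : Cube d) : Set (Rd d) :=
  {x | ∀ i, Q.corner i ≤ x i ∧ x i ≤ Q.corner i + Q.side}

/-- The concentric triple `3Q` of a cube. -/
def triple {d : ℕ} (Q : Cube d) : Set (Rd d) :=
  {x | ∀ i, Q.corner i - Q.side ≤ x i ∧ x i ≤ Q.corner i + 2 * Q.side}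

end Cube

/-- Operator norm of an `n × n` complex matrix acting on `ℂⁿ` with the Euclidean norm. -/
def opNorm {n : ℕ} (A : Mat n) : ℝ := ‖Matrix.toEuclideanCLM (𝕜 := ℂ) (n := Fin n) A‖

/-- A matrix acting on a Euclidean vector. -/
def mvec {n : ℕ} (A : Mat n) (v : Vec n) : Vec n := Matrix.toEuclideanLin A v

/-- Fractional power of a Hermitian matrix via the spectral calculus (junk value `1`
for non-Hermitian matrices). -/
def matPow {n : ℕ} (A : Mat n) (s : ℝ) : Mat n :=
  if h : A.IsHermitian then
    (h.eigenvectorUnitary : Mat n) *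
      Matrix.diagonal (fun i => ((h.eigenvalues i ^ s : ℝ) : ℂ)) *
      star (h.eigenvectorUnitary : Mat n)
  else 1

/-- A matrix weight: measurable, positive definite (hence Hermitian) a.e. -/
def IsMatrixWeight {d n : ℕ} (W : Rd d → Mat n) : Prop :=
  (∀ i j, Measurable fun x => W x i j) ∧ ∀ᵐ x : Rd d, (W x).PosDef


/-- Componentwise measurability of a `ℂⁿ`-valued function. -/
def MeasurableV {d n : ℕ} (f : Rd d → Vec n) : Prop := ∀ i, Measurable fun x => f x i

section CStarAlgebra

open CFC

variable {E : Type*} [CStarAlgebra E] [PartialOrder E] [StarOrderedRing E]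

lemma smul_rpow {a : E} (ha : IsStrictlyPositive a) {c : ℝ} (hc : 0 ≤ c) {t : ℝ} (ht : 0 ≤ t) :
    (c • a) ^ t = c ^ t • a ^ t := by
  have hpos := ha.nonneg
  rw [rpow_eq_cfc_real (smul_nonneg hc hpos), rpow_eq_cfc_real hpos,
    ← cfc_comp_smul c (fun x : ℝ => x ^ t) a (Real.continuous_rpow_const ht).continuousOn,
    ← cfc_smul (c ^ t) (fun x : ℝ => x ^ t) a (Real.continuous_rpow_const ht).continuousOn]
  refine cfc_congr fun x hx => ?_
  simp only [smul_eq_mul]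
  exact Real.mul_rpow hc (spectrum_nonneg_of_nonneg hpos hx)

lemma star_mul_self_rpow_mul_rpow_neg {a : E} (ha : IsStrictlyPositive a) (b : E) (r : ℝ) :
    star (a ^ r * b ^ (-r)) * (a ^ r * b ^ (-r)) = b ^ (-r) * a ^ (2 * r) * b ^ (-r) := by
  have hsa : star (a ^ r) = a ^ r := (IsSelfAdjoint.of_nonneg rpow_nonneg).star_eq
  have hsb : star (b ^ (-r)) = b ^ (-r) := (IsSelfAdjoint.of_nonneg rpow_nonneg).star_eq
  rw [star_mul, hsa, hsb, two_mul, rpow_add ha.isUnit]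
  simp only [mul_assoc]

/-- `‖a ^ r * b ^ (-r)‖ ^ 2` bounds `a ^ (2 * r)` by a multiple of `b ^ (2 * r)`. -/
lemma rpow_le_norm_sq_smul_rpow {a b : E} (ha : IsStrictlyPositive a) (hb : IsStrictlyPositive b)
    (r : ℝ) : a ^ (2 * r) ≤ ‖a ^ r * b ^ (-r)‖ ^ 2 • b ^ (2 * r) := by
  have h := conjugate_le_conjugate_of_nonneg
    (CStarAlgebra.star_mul_le_algebraMap_norm_sq (a := a ^ r * b ^ (-r)))
    (rpow_nonneg (a := b) (y := r))
  rw [star_mul_self_rpow_mul_rpow_neg ha] at h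
  calc a ^ (2 * r) = (b ^ r * b ^ (-r)) * a ^ (2 * r) * (b ^ (-r) * b ^ r) := by
        rw [rpow_mul_rpow_neg r hb, rpow_neg_mul_rpow r hb, one_mul, mul_one]
    _ = b ^ r * (b ^ (-r) * a ^ (2 * r) * b ^ (-r)) * b ^ r := by simp only [mul_assoc]
    _ ≤ _ := h
    _ = _ := by
        rw [Algebra.algebraMap_eq_smul_one, mul_smul_comm, mul_one, smul_mul_assoc, two_mul r,
          rpow_add hb.isUnit]

/-- The **Cordes inequality**, a norm form of the Löwner–Heinz inequality. -/
lemma norm_rpow_mul_rpow_neg_le {a b : E} (ha : IsStrictlyPositive a) (hb : IsStrictlyPositive b)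
    {r t : ℝ} (hr : r ≠ 0) (ht : t ∈ Set.Icc (0 : ℝ) 1) :
    ‖a ^ (r * t) * b ^ (-(r * t))‖ ≤ ‖a ^ r * b ^ (-r)‖ ^ t := by
  set c := ‖a ^ r * b ^ (-r)‖
  have hc : 0 ≤ c := norm_nonneg _
  have h2r : 2 * r ≠ 0 := mul_ne_zero two_ne_zero hr
  have h₁ := rpow_le_rpow ht (rpow_le_norm_sq_smul_rpow ha hb r)
  rw [smul_rpow (IsStrictlyPositive.rpow b _ hb) (sq_nonneg _) ht.1, rpow_rpow a _ _ h2r ha,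
    rpow_rpow b _ _ h2r hb, mul_assoc] at h₁
  have h₂ := conjugate_le_conjugate_of_nonneg h₁ (rpow_nonneg (a := b) (y := -(r * t)))
  rw [← star_mul_self_rpow_mul_rpow_neg ha, mul_smul_comm, smul_mul_assoc, two_mul,
    rpow_add hb.isUnit, ← mul_assoc (b ^ (-(r * t))) (b ^ (r * t)),
    rpow_neg_mul_rpow _ hb, one_mul,
    rpow_mul_rpow_neg _ hb,
    ← Algebra.algebraMap_eq_smul_one] at h₂
  have h₃ := (CStarAlgebra.norm_le_iff_le_algebraMap _ (by positivity)
    (star_mul_self_nonneg _)).mpr h₂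
  rw [CStarRing.norm_star_mul_self, ← sq, sq c, Real.mul_rpow hc hc, ← sq] at h₃
  exact (sq_le_sq₀ (norm_nonneg _) (Real.rpow_nonneg hc t)).mp h₃

end CStarAlgebra

section Matrix

open scoped MatrixOrder Matrix.Norms.L2Operator

lemma matPow_eq_rpow {n : ℕ} {A : Mat n} (hA : A.PosDef) (s : ℝ) : matPow A s = A ^ s := by
  rw [CFC.rpow_eq_cfc_real hA.posSemidef.nonneg, hA.isHermitian.cfc_eq, matPow,
    dif_pos hA.isHermitian, Matrix.IsHermitian.cfc, Unitary.conjStarAlgAut_apply]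
  rfl

lemma opNorm_matPow_mul_matPow_neg_le {n : ℕ} {A B : Mat n} (hA : A.PosDef) (hB : B.PosDef)
    {r t : ℝ} (hr : r ≠ 0) (ht : t ∈ Set.Icc (0 : ℝ) 1) :
    opNorm (matPow A (r * t) * matPow B (-(r * t))) ≤
      opNorm (matPow A r * matPow B (-r)) ^ t := by
  simp only [matPow_eq_rpow hA, matPow_eq_rpow hB]
  exact norm_rpow_mul_rpow_neg_le hA.isStrictlyPositive hB.isStrictlyPositive hr ht

end Matrix

/-- Hölder–McCarthy-type estimate for fractional powers of positive definite matrices: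
`‖A^{1/p} B^{-1/p}‖ ≤ n ‖A^{1/q} B^{-1/q}‖^{q/p}` for `1 ≤ q < p`. -/
theorem opNorm_matPow_le (n : ℕ) (hn : 1 ≤ n) (p q : ℝ) (hq : 1 ≤ q) (hqp : q < p)
    (A B : Mat n) (hA : A.PosDef) (hB : B.PosDef) :
    opNorm (matPow A (1/p) * matPow B (-(1/p))) ≤
      (n : ℝ) * opNorm (matPow A (1/q) * matPow B (-(1/q))) ^ (q/p) := by
  have hq₀ : 0 < q := by linarith
  have hp₀ : 0 < p := by linarith
  have h := opNorm_matPow_mul_matPow_neg_le hA hB (one_div_ne_zero hq₀.ne')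
    ⟨div_nonneg hq₀.le hp₀.le, (div_le_one hp₀).mpr hqp.le⟩
  rw [show 1 / q * (q / p) = 1 / p by field_simp] at h
  exact h.trans (le_mul_of_one_le_left (Real.rpow_nonneg (norm_nonneg _) _) (mod_cast hn))

end
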